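/- arXiv:1708.04876 — 17 statements merged into one kernel-verified Lean document; each statement's English description precedes it below -/
import Mathlib

section
/- Let C be the isotropic elasticity tensor with Lamé parameters λ, μ ∈ ℝ, and assume λ + 2μ ≠ μ (equivalently λ + μ ≠ 0). Then a real number θ is an M-eigenvalue of C if and only if θ = μ or θ = λ + 2μ. -/
/-- The isotropic elasticity tensor with Lamé parameters `lam`, `mu`. -/
def isoC (lam mu : ℝ) : Fin 3 → Fin 3 → Fin 3 → Fin 3 → ℝ :=
  fun i j k l =>
    lam * (if i = j then (1 : ℝ) else 0) * (if k = l then (1 : ℝ) else 0)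
    + mu * ((if i = k then (1 : ℝ) else 0) * (if j = l then (1 : ℝ) else 0)
        + (if i = l then (1 : ℝ) else 0) * (if j = k then (1 : ℝ) else 0))

/-- θ is an M-eigenvalue of the fourth-order tensor `C`. -/
def IsMEigenvalue (C : Fin 3 → Fin 3 → Fin 3 → Fin 3 → ℝ) (θ : ℝ) : Prop :=
  ∃ x y : Fin 3 → ℝ,
    (∑ i, x i ^ 2) = 1 ∧ (∑ i, y i ^ 2) = 1 ∧
    (∀ i, (∑ j, ∑ k, ∑ l, C i j k l * y j * x k * y l) = θ * x i) ∧
    (∀ l, (∑ i, ∑ j, ∑ k, C i j k l * x i * y j * x k) = θ * y l)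

/-- Contracting the isotropic tensor with `y`, `x`, `y` in its last three slots. -/
theorem isoC_contract_left (lam mu : ℝ) (x y : Fin 3 → ℝ) (i : Fin 3) :
    (∑ j, ∑ k, ∑ l, isoC lam mu i j k l * y j * x k * y l)
      = (lam + mu) * (∑ j, x j * y j) * y i + mu * (∑ j, y j ^ 2) * x i := by
  fin_cases i <;> simp [isoC, Fin.sum_univ_three] <;> ring

/-- Contracting the isotropic tensor with `x`, `y`, `x` in its first three slots. -/
theorem isoC_contract_right (lam mu : ℝ) (x y : Fin 3 → ℝ) (l : Fin 3) :
    (∑ i, ∑ j, ∑ k, isoC lam mu i j k l * x i * y j * x k)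
      = (lam + mu) * (∑ j, x j * y j) * x l + mu * (∑ j, x j ^ 2) * y l := by
  fin_cases l <;> simp [isoC, Fin.sum_univ_three] <;> ring

theorem stmt1 (lam mu : ℝ) (h : lam + mu ≠ 0) (θ : ℝ) :
    IsMEigenvalue (isoC lam mu) θ ↔ θ = mu ∨ θ = lam + 2 * mu := by
  simp only [IsMEigenvalue, isoC_contract_left, isoC_contract_right]
  constructor
  · rintro ⟨x, y, hx, hy, hxy, -⟩
    rw [hy] at hxy
    generalize hs : ∑ j, x j * y j = s at hxy
    have hdot : ∀ z : Fin 3 → ℝ, (lam + mu) * s * ∑ i, z i * y i = (θ - mu) * ∑ i, z i * x i := by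
      intro z
      rw [Finset.mul_sum, Finset.mul_sum]
      refine Finset.sum_congr rfl fun i _ => ?_
      linear_combination z i * hxy i
    have hdx : (lam + mu) * s * s = θ - mu := by
      simpa [hs, ← pow_two, hx] using hdot x
    have hdy : (lam + mu) * s = (θ - mu) * s := by
      simpa [← pow_two, hy, hs, mul_comm (y _) (x _)] using hdot y
    by_cases hs0 : s = 0
    · left
      rw [hs0] at hdx
      linarith
    · right
      linarith [mul_right_cancel₀ hs0 hdy]
  · rintro (rfl | rfl)
    · refine ⟨![1, 0, 0], ![0, 1, 0], ?_, ?_, fun i => ?_, fun i => ?_⟩ <;>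
        simp [Fin.sum_univ_three]
    · refine ⟨![1, 0, 0], ![1, 0, 0], ?_, ?_, fun i => ?_, fun i => ?_⟩ <;>
        simp [Fin.sum_univ_three] <;> ring
end

section
/- Let C be the isotropic elasticity tensor with Lamé parameters λ, μ ∈ ℝ. Then a real number η is a Z-eigenvalue of C if and only if η = λ + 2μ. -/
/-- η is a Z-eigenvalue of the fourth-order tensor `C`. -/
def IsZEigenvalue (C : Fin 3 → Fin 3 → Fin 3 → Fin 3 → ℝ) (η : ℝ) : Prop :=
  ∃ x : Fin 3 → ℝ,
    (∑ i, x i ^ 2) = 1 ∧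
    (∀ i, (∑ j, ∑ k, ∑ l, C i j k l * x j * x k * x l) = η * x i)

/-- Contracting the isotropic elasticity tensor three times with `x` gives
`(lam + 2 * mu) * |x|² • x`. -/
theorem isoC_contract (lam mu : ℝ) (x : Fin 3 → ℝ) (i : Fin 3) :
    ∑ j, ∑ k, ∑ l, isoC lam mu i j k l * x j * x k * x l =
      (lam + 2 * mu) * (∑ j, x j ^ 2) * x i := by
  fin_cases i <;> simp [isoC, Fin.sum_univ_three] <;> ring

theorem stmt3 (lam mu : ℝ) (η : ℝ) :
    IsZEigenvalue (isoC lam mu) η ↔ η = lam + 2 * mu := by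
  constructor
  · rintro ⟨x, hx, h⟩
    obtain ⟨i, hi⟩ : ∃ i, x i ≠ 0 := by
      by_contra! h0
      simp [h0] at hx
    have hxi := h i
    rw [isoC_contract, hx, mul_one] at hxi
    exact (mul_right_cancel₀ hi hxi).symm
  · rintro rfl
    have hx : ∑ i, (Pi.single 0 1 : Fin 3 → ℝ) i ^ 2 = 1 := by
      simp [Fin.sum_univ_three]
    exact ⟨Pi.single 0 1, hx, fun i => by rw [isoC_contract, hx, mul_one]⟩
end

section
/- Let C be the cubic elasticity tensor with parameters β₁, β₂, β₃ ∈ ℝ. Then each of the five numbers β₁, β₂, (β₁ − β₃)/2, (β₁ + 2β₂ + β₃)/2, and (β₁ + 4β₂ + 2β₃)/3 is an M-eigenvalue of C. -/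
/-- The cubic elasticity tensor with parameters `b1`, `b2`, `b3`. -/
def cubicC (b1 b2 b3 : ℝ) : Fin 3 → Fin 3 → Fin 3 → Fin 3 → ℝ :=
  fun i j k l =>
    if i = j ∧ j = k ∧ k = l then b1
    else if i ≠ j ∧ ((i = k ∧ j = l) ∨ (i = l ∧ j = k)) then b2
    else if i = j ∧ k = l ∧ i ≠ k then b3
    else 0

theorem cubicC_contract_left (b1 b2 b3 : ℝ) (x y : Fin 3 → ℝ) (i : Fin 3) :
    (∑ j, ∑ k, ∑ l, cubicC b1 b2 b3 i j k l * y j * x k * y l) =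
      (b1 * y i ^ 2 + b2 * (∑ j, y j ^ 2 - y i ^ 2)) * x i +
        (b2 + b3) * y i * (∑ j, x j * y j - x i * y i) := by
  fin_cases i <;> simp [Fin.sum_univ_three, cubicC] <;> ring

theorem cubicC_contract_right (b1 b2 b3 : ℝ) (x y : Fin 3 → ℝ) (l : Fin 3) :
    (∑ i, ∑ j, ∑ k, cubicC b1 b2 b3 i j k l * x i * y j * x k) =
      (b1 * x l ^ 2 + b2 * (∑ j, x j ^ 2 - x l ^ 2)) * y l +
        (b2 + b3) * x l * (∑ j, x j * y j - x l * y l) := by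
  fin_cases l <;> simp [Fin.sum_univ_three, cubicC] <;> ring

/-- The M-eigenvalue condition for the cubic tensor, with the contractions evaluated. -/
theorem isMEigenvalue_cubicC {b1 b2 b3 θ : ℝ} (x y : Fin 3 → ℝ)
    (hx : ∑ i, x i ^ 2 = 1) (hy : ∑ i, y i ^ 2 = 1)
    (hxy : ∀ i, (b1 * y i ^ 2 + b2 * (1 - y i ^ 2)) * x i +
      (b2 + b3) * y i * (∑ j, x j * y j - x i * y i) = θ * x i)
    (hyx : ∀ i, (b1 * x i ^ 2 + b2 * (1 - x i ^ 2)) * y i +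
      (b2 + b3) * x i * (∑ j, x j * y j - x i * y i) = θ * y i) :
    IsMEigenvalue (cubicC b1 b2 b3) θ := by
  refine ⟨x, y, hx, hy, fun i => ?_, fun l => ?_⟩
  · rw [cubicC_contract_left, hy, hxy]
  · rw [cubicC_contract_right, hx, hyx]

theorem stmt4 (b1 b2 b3 : ℝ) :
    IsMEigenvalue (cubicC b1 b2 b3) b1 ∧
    IsMEigenvalue (cubicC b1 b2 b3) b2 ∧
    IsMEigenvalue (cubicC b1 b2 b3) ((b1 - b3) / 2) ∧
    IsMEigenvalue (cubicC b1 b2 b3) ((b1 + 2 * b2 + b3) / 2) ∧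
    IsMEigenvalue (cubicC b1 b2 b3) ((b1 + 4 * b2 + 2 * b3) / 3) := by
  obtain ⟨s, hs⟩ : ∃ s : ℝ, s ^ 2 = 1 / 2 := ⟨√(1 / 2), Real.sq_sqrt (by norm_num)⟩
  obtain ⟨t, ht⟩ : ∃ t : ℝ, t ^ 2 = 1 / 3 := ⟨√(1 / 3), Real.sq_sqrt (by norm_num)⟩
  refine ⟨isMEigenvalue_cubicC ![1, 0, 0] ![1, 0, 0] ?_ ?_ ?_ ?_,
    isMEigenvalue_cubicC ![1, 0, 0] ![0, 1, 0] ?_ ?_ ?_ ?_,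
    isMEigenvalue_cubicC ![s, s, 0] ![s, -s, 0] ?_ ?_ ?_ ?_,
    isMEigenvalue_cubicC ![s, s, 0] ![s, s, 0] ?_ ?_ ?_ ?_,
    isMEigenvalue_cubicC ![t, t, t] ![t, t, t] ?_ ?_ ?_ ?_⟩
  all_goals try intro i; fin_cases i
  all_goals simp [Fin.sum_univ_three]
  all_goals grind
end

section
/- Let C be the cubic elasticity tensor with parameters β₁, β₂, β₃ ∈ ℝ, and set S = 3β₁ + 2β₂ + 5β₃. Assume S ≠ 0, (β₁ + β₃)/S ≥ 0, and (β₁ + 2β₂ + 3β₃)/S ≥ 0. Then θ₆ = (β₁² + 2β₁β₂ + β₁β₃ − 2β₃²)/S is an M-eigenvalue of C. -/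
theorem stmt5 (b1 b2 b3 : ℝ) (hS : 3 * b1 + 2 * b2 + 5 * b3 ≠ 0)
    (h1 : (b1 + b3) / (3 * b1 + 2 * b2 + 5 * b3) ≥ 0)
    (h2 : (b1 + 2 * b2 + 3 * b3) / (3 * b1 + 2 * b2 + 5 * b3) ≥ 0) :
    IsMEigenvalue (cubicC b1 b2 b3)
      ((b1 ^ 2 + 2 * b1 * b2 + b1 * b3 - 2 * b3 ^ 2) / (3 * b1 + 2 * b2 + 5 * b3)) := by
  have hs := Real.sq_sqrt h1
  have ht := Real.sq_sqrt h2
  set u := √((b1 + b3) / (3 * b1 + 2 * b2 + 5 * b3))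
  set v := √((b1 + 2 * b2 + 3 * b3) / (3 * b1 + 2 * b2 + 5 * b3))
  have hsum : 2 * u ^ 2 + v ^ 2 = 1 := by
    rw [hs, ht, ← mul_div_assoc, ← add_div, div_eq_one_iff_eq hS]; ring
  have hu : b1 * u ^ 2 + b2 * (2 * u ^ 2) + b3 * (u ^ 2 - v ^ 2) =
      (b1 ^ 2 + 2 * b1 * b2 + b1 * b3 - 2 * b3 ^ 2) / (3 * b1 + 2 * b2 + 5 * b3) := by
    rw [hs, ht]; field_simp; ring
  have hv : b1 * v ^ 2 - b3 * (2 * u ^ 2) =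
      (b1 ^ 2 + 2 * b1 * b2 + b1 * b3 - 2 * b3 ^ 2) / (3 * b1 + 2 * b2 + 5 * b3) := by
    rw [hs, ht]; field_simp; ring
  refine ⟨![u, u, v], ![u, u, -v], ?_, ?_, fun i => ?_, fun l => ?_⟩
  · simp [Fin.sum_univ_three]; linarith
  · simp [Fin.sum_univ_three]; linarith
  · fin_cases i
    · simp [Fin.sum_univ_three, cubicC]; linear_combination u * hu
    · simp [Fin.sum_univ_three, cubicC]; linear_combination u * hu
    · simp [Fin.sum_univ_three, cubicC]; linear_combination v * hv
  · fin_cases l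
    · simp [Fin.sum_univ_three, cubicC]; linear_combination u * hu
    · simp [Fin.sum_univ_three, cubicC]; linear_combination u * hu
    · simp [Fin.sum_univ_three, cubicC]; linear_combination -v * hv
end

section
/- Let C be the cubic elasticity tensor with parameters β₁, β₂, β₃ ∈ ℝ. If C is strongly elliptic, then β₁ > 0, β₂ > 0, and |β₃ + β₂| < β₁ + β₂. -/
/-- The fourth-order tensor `C` is strongly elliptic. -/
def StronglyElliptic (C : Fin 3 → Fin 3 → Fin 3 → Fin 3 → ℝ) : Prop :=
  ∀ x y : Fin 3 → ℝ, x ≠ 0 → y ≠ 0 →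
    0 < ∑ i, ∑ j, ∑ k, ∑ l, C i j k l * x i * y j * x k * y l

theorem stmt6 (b1 b2 b3 : ℝ) (h : StronglyElliptic (cubicC b1 b2 b3)) :
    b1 > 0 ∧ b2 > 0 ∧ |b3 + b2| < b1 + b2 := by
  have h₁ := h ![1, 0, 0] ![1, 0, 0] (by simp) (by simp)
  have h₂ := h ![1, 0, 0] ![0, 1, 0] (by simp) (by simp)
  have h₃ := h ![1, 1, 0] ![1, 1, 0] (by simp) (by simp)
  have h₄ := h ![1, 1, 0] ![1, -1, 0] (by simp) (by simp)
  simp [Fin.sum_univ_three, cubicC] at h₁ h₂ h₃ h₄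
  exact ⟨h₁, h₂, abs_lt.mpr ⟨by linarith, by linarith⟩⟩
end

section
/- Let C be the cubic elasticity tensor with parameters β₁, β₂, β₃ ∈ ℝ. If β₁ > 0, β₂ > 0, β₁ > β₃, β₁ + 2β₂ + β₃ > 0, β₁ + 4β₂ + 2β₃ > 0, and β₁ + 2β₃ > 0, then C is strongly elliptic. -/
theorem sum_cubicC_eq (b1 b2 b3 : ℝ) (x y : Fin 3 → ℝ) :
    ∑ i, ∑ j, ∑ k, ∑ l, cubicC b1 b2 b3 i j k l * x i * y j * x k * y l =
      (b1 + 2 * b3) / 3 * (x 0 * y 0 + x 1 * y 1 + x 2 * y 2) ^ 2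
      + (b1 - b3) / 3 * ((x 0 * y 0 - x 1 * y 1) ^ 2 + (x 0 * y 0 - x 2 * y 2) ^ 2
        + (x 1 * y 1 - x 2 * y 2) ^ 2)
      + b2 * ((x 0 * y 1 + x 1 * y 0) ^ 2 + (x 0 * y 2 + x 2 * y 0) ^ 2
        + (x 1 * y 2 + x 2 * y 1) ^ 2) := by
  simp [Fin.sum_univ_three, cubicC]
  ring

theorem eq_zero_of_sum_three_sq_eq_zero {a b c : ℝ} (h : a ^ 2 + b ^ 2 + c ^ 2 = 0) :
    a = 0 ∧ b = 0 ∧ c = 0 := by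
  have ha := sq_nonneg a
  have hb := sq_nonneg b
  have hc := sq_nonneg c
  refine ⟨?_, ?_, ?_⟩ <;> exact (pow_eq_zero_iff two_ne_zero).mp (by linarith)

/-- If the symmetric part of `x ⊗ y` vanishes, then so does `x` or `y`. -/
theorem eq_zero_or_eq_zero_of_symm_mul_eq_zero {ι : Type*} {x y : ι → ℝ}
    (h : ∀ i j, x i * y j + x j * y i = 0) : x = 0 ∨ y = 0 := by
  by_contra! hxy
  obtain ⟨i, hi⟩ := Function.ne_iff.mp hxy.1
  obtain ⟨j, hj⟩ := Function.ne_iff.mp hxy.2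
  have hyi : y i = 0 := by
    have : x i * y i = 0 := by linarith [h i i]
    exact (mul_eq_zero.mp this).resolve_left hi
  have hij : x i * y j = 0 := by simpa [hyi] using h i j
  exact mul_ne_zero hi hj hij

theorem stmt7 (b1 b2 b3 : ℝ)
    (h1 : b1 > 0) (h2 : b2 > 0) (h3 : b1 > b3)
    (h4 : b1 + 2 * b2 + b3 > 0) (h5 : b1 + 4 * b2 + 2 * b3 > 0)
    (h6 : b1 + 2 * b3 > 0) :
    StronglyElliptic (cubicC b1 b2 b3) := by
  intro x y hx hy
  rw [sum_cubicC_eq]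
  have hb : 0 < (b1 + 2 * b3) / 3 := by linarith
  have hc : 0 < (b1 - b3) / 3 := by linarith
  by_contra! hle
  obtain ⟨hs, hd, he⟩ : (x 0 * y 0 + x 1 * y 1 + x 2 * y 2) ^ 2 = 0 ∧
      (x 0 * y 0 - x 1 * y 1) ^ 2 + (x 0 * y 0 - x 2 * y 2) ^ 2
        + (x 1 * y 1 - x 2 * y 2) ^ 2 = 0 ∧
      (x 0 * y 1 + x 1 * y 0) ^ 2 + (x 0 * y 2 + x 2 * y 0) ^ 2
        + (x 1 * y 2 + x 2 * y 1) ^ 2 = 0 := by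
    refine ⟨?_, ?_, ?_⟩ <;>
    · by_contra hne
      have hpos := lt_of_le_of_ne (by positivity) (Ne.symm hne)
      exact hle.not_gt (by positivity)
  have hs0 := pow_eq_zero_iff two_ne_zero |>.mp hs
  obtain ⟨hd1, hd2, -⟩ := eq_zero_of_sum_three_sq_eq_zero hd
  obtain ⟨he1, he2, he3⟩ := eq_zero_of_sum_three_sq_eq_zero he
  refine (eq_zero_or_eq_zero_of_symm_mul_eq_zero (x := x) (y := y) fun i j => ?_).elim hx hy
  fin_cases i <;> fin_cases j <;> simp only [Fin.zero_eta, Fin.mk_one, Fin.reduceFinMk] <;> linarith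
end

section
/- Let C be the cubic elasticity tensor with parameters β₁, β₂, β₃ ∈ ℝ. Then each of the three numbers β₁, (β₁ + β₃)/2 + β₂, and (β₁ + 4β₂ + 2β₃)/3 is a Z-eigenvalue of C. -/
/-- The cubic form gradient of `cubicC`, written out in coordinates. -/
theorem cubicC_contract (b1 b2 b3 : ℝ) (x : Fin 3 → ℝ) (i : Fin 3) :
    (∑ j, ∑ k, ∑ l, cubicC b1 b2 b3 i j k l * x j * x k * x l) =
      (b1 * x i ^ 2 + (2 * b2 + b3) * ((∑ j, x j ^ 2) - x i ^ 2)) * x i := by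
  fin_cases i <;> simp [cubicC, Fin.sum_univ_three] <;> ring

/-- A unit vector whose nonzero coordinates all have square `t` is a Z-eigenvector. -/
theorem isZEigenvalue_cubicC (b1 b2 b3 t : ℝ) (x : Fin 3 → ℝ) (hx : ∑ i, x i ^ 2 = 1)
    (ht : ∀ i, x i = 0 ∨ x i ^ 2 = t) :
    IsZEigenvalue (cubicC b1 b2 b3) (b1 * t + (2 * b2 + b3) * (1 - t)) := by
  refine ⟨x, hx, fun i => ?_⟩
  rw [cubicC_contract, hx]
  rcases ht i with h | h
  · simp [h]
  · rw [h]

theorem stmt8 (b1 b2 b3 : ℝ) :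
    IsZEigenvalue (cubicC b1 b2 b3) b1 ∧
    IsZEigenvalue (cubicC b1 b2 b3) ((b1 + b3) / 2 + b2) ∧
    IsZEigenvalue (cubicC b1 b2 b3) ((b1 + 4 * b2 + 2 * b3) / 3) := by
  have h2 : (√(1 / 2) : ℝ) ^ 2 = 1 / 2 := Real.sq_sqrt (by norm_num)
  have h3 : (√(1 / 3) : ℝ) ^ 2 = 1 / 3 := Real.sq_sqrt (by norm_num)
  refine ⟨?_, ?_, ?_⟩
  · convert isZEigenvalue_cubicC b1 b2 b3 1 ![1, 0, 0] (by simp [Fin.sum_univ_three])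
      (by intro i; fin_cases i <;> simp) using 1
    ring
  · convert isZEigenvalue_cubicC b1 b2 b3 (1 / 2) ![√(1 / 2), √(1 / 2), 0]
      (by
        simp only [Fin.sum_univ_three, Matrix.cons_val, h2]
        norm_num)
      (by
        intro i
        fin_cases i
        exacts [.inr h2, .inr h2, .inl rfl]) using 1
    ring
  · convert isZEigenvalue_cubicC b1 b2 b3 (1 / 3) (fun _ => √(1 / 3))
      (by
        simp only [Fin.sum_univ_three, h3]
        norm_num)
      (fun _ => .inr h3) using 1
    ring
end

section
/- Let C be the transversely isotropic elasticity tensor with parameters α₁, α₂, α₃, α₄, α₅ ∈ ℝ. Then each of the four numbers α₁, α₂, α₃, and α₄ is an M-eigenvalue of C. -/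
/-- The orthotropic elasticity tensor with parameters `d1, …, d9`. -/
def orthoC (d1 d2 d3 d4 d5 d6 d7 d8 d9 : ℝ) : Fin 3 → Fin 3 → Fin 3 → Fin 3 → ℝ :=
  fun i j k l =>
    if i = j ∧ j = k ∧ k = l then ![d1, d2, d3] i
    else if i ≠ j ∧ ((i = k ∧ j = l) ∨ (i = l ∧ j = k)) then
      (if (i = 1 ∧ j = 2) ∨ (i = 2 ∧ j = 1) then d4
       else if (i = 0 ∧ j = 2) ∨ (i = 2 ∧ j = 0) then d5
       else d6)
    else if i = j ∧ k = l ∧ i ≠ k then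
      (if (i = 1 ∧ k = 2) ∨ (i = 2 ∧ k = 1) then d7
       else if (i = 0 ∧ k = 2) ∨ (i = 2 ∧ k = 0) then d8
       else d9)
    else 0

/-- The transversely isotropic (polar anisotropic) elasticity tensor
with parameters `a1, …, a5`. -/
def transC (a1 a2 a3 a4 a5 : ℝ) : Fin 3 → Fin 3 → Fin 3 → Fin 3 → ℝ :=
  orthoC a1 a1 a2 a3 a3 a4 a5 a5 (a1 - 2 * a4)

/-- Standard basis vectors `e_p`, `e_q` give an M-eigenvalue `θ` as soon as the corresponding
slices of the tensor are `θ • e_p` and `θ • e_q`. -/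
theorem isMEigenvalue_of_single {C : Fin 3 → Fin 3 → Fin 3 → Fin 3 → ℝ} {θ : ℝ} (p q : Fin 3)
    (hp : ∀ i, C i q p q = θ * (Pi.single p 1 : Fin 3 → ℝ) i)
    (hq : ∀ l, C p q p l = θ * (Pi.single q 1 : Fin 3 → ℝ) l) :
    IsMEigenvalue C θ := by
  refine ⟨Pi.single p 1, Pi.single q 1, ?_, ?_, fun i => ?_, fun l => ?_⟩
  · simp [Pi.single_apply]
  · simp [Pi.single_apply]
  · rw [← hp i]
    simp [Pi.single_apply]
  · rw [← hq l]
    simp [Pi.single_apply]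

theorem stmt9 (a1 a2 a3 a4 a5 : ℝ) :
    IsMEigenvalue (transC a1 a2 a3 a4 a5) a1 ∧
    IsMEigenvalue (transC a1 a2 a3 a4 a5) a2 ∧
    IsMEigenvalue (transC a1 a2 a3 a4 a5) a3 ∧
    IsMEigenvalue (transC a1 a2 a3 a4 a5) a4 := by
  refine ⟨isMEigenvalue_of_single 0 0 ?_ ?_, isMEigenvalue_of_single 2 2 ?_ ?_,
    isMEigenvalue_of_single 2 1 ?_ ?_, isMEigenvalue_of_single 0 1 ?_ ?_⟩ <;>
  · intro m
    fin_cases m <;> simp [transC, orthoC]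
end

section
/- Let C be the transversely isotropic elasticity tensor with parameters α₁, α₂, α₃, α₄, α₅ ∈ ℝ. If α₁ + α₂ + 2α₅ > 0, α₁ + α₅ ≥ 0, and α₂ + α₅ ≥ 0, then θ₅ = (α₁α₂ − α₅²)/(α₁ + α₂ + 2α₅) is an M-eigenvalue of C. -/
theorem stmt10 (a1 a2 a3 a4 a5 : ℝ)
    (h : a1 + a2 + 2 * a5 > 0) (h1 : a1 + a5 ≥ 0) (h2 : a2 + a5 ≥ 0) :
    IsMEigenvalue (transC a1 a2 a3 a4 a5)
      ((a1 * a2 - a5 ^ 2) / (a1 + a2 + 2 * a5)) := by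
  have hD : a1 + a2 + 2 * a5 ≠ 0 := h.ne'
  obtain ⟨c, hc⟩ : ∃ c : ℝ, c ^ 2 = (a2 + a5) / (a1 + a2 + 2 * a5) :=
    ⟨_, Real.sq_sqrt (div_nonneg h2 h.le)⟩
  obtain ⟨s, hs⟩ : ∃ s : ℝ, s ^ 2 = (a1 + a5) / (a1 + a2 + 2 * a5) :=
    ⟨_, Real.sq_sqrt (div_nonneg h1 h.le)⟩
  have hcs : c ^ 2 + s ^ 2 = 1 := by
    rw [hc, hs, ← add_div, div_eq_one_iff_eq hD]; ring
  have hθ₁ : (a1 * a2 - a5 ^ 2) / (a1 + a2 + 2 * a5) = a1 * c ^ 2 - a5 * s ^ 2 := by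
    rw [hc, hs]; field_simp; ring
  have hθ₂ : a1 * c ^ 2 - a5 * s ^ 2 = a2 * s ^ 2 - a5 * c ^ 2 := by
    rw [hc, hs]; field_simp; ring
  rw [hθ₁]
  refine ⟨![c, 0, s], ![c, 0, -s], ?_, ?_, ?_, ?_⟩
  · simpa [Fin.sum_univ_three] using hcs
  · simpa [Fin.sum_univ_three] using hcs
  · intro i
    fin_cases i <;> simp [Fin.sum_univ_three, transC, orthoC]
    · ring
    · linear_combination (-s) * hθ₂
  · intro l
    fin_cases l <;> simp [Fin.sum_univ_three, transC, orthoC]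
    · ring
    · linear_combination s * hθ₂
end

section
/- Let C be the transversely isotropic elasticity tensor with parameters α₁, α₂, α₃, α₄, α₅ ∈ ℝ, and set D = 4α₃ + 2α₅ − α₁ − α₂. If D ≠ 0, (2α₃ + α₅ − α₁)/D ≥ 0, and (2α₃ + α₅ − α₂)/D ≥ 0, then θ₆ = (α₁α₂ − (2α₃ + α₅)²)/(α₁ + α₂ − 2(2α₃ + α₅)) is an M-eigenvalue of C. -/
theorem stmt11 (a1 a2 a3 a4 a5 : ℝ)
    (hD : 4 * a3 + 2 * a5 - a1 - a2 ≠ 0)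
    (h1 : (2 * a3 + a5 - a1) / (4 * a3 + 2 * a5 - a1 - a2) ≥ 0)
    (h2 : (2 * a3 + a5 - a2) / (4 * a3 + 2 * a5 - a1 - a2) ≥ 0) :
    IsMEigenvalue (transC a1 a2 a3 a4 a5)
      ((a1 * a2 - (2 * a3 + a5) ^ 2) / (a1 + a2 - 2 * (2 * a3 + a5))) := by
  have hD' : a1 + a2 - 2 * (2 * a3 + a5) ≠ 0 := fun h => hD (by linarith)
  have hs := (eq_div_iff hD).1 (Real.sq_sqrt h2)
  have ht := (eq_div_iff hD).1 (Real.sq_sqrt h1)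
  set s := √((2 * a3 + a5 - a2) / (4 * a3 + 2 * a5 - a1 - a2))
  set t := √((2 * a3 + a5 - a1) / (4 * a3 + 2 * a5 - a1 - a2))
  have hst : s ^ 2 + t ^ 2 = 1 := by
    apply mul_right_cancel₀ hD
    linear_combination hs + ht
  have e1 : a1 * s ^ 2 + (2 * a3 + a5) * t ^ 2 =
      (a1 * a2 - (2 * a3 + a5) ^ 2) / (a1 + a2 - 2 * (2 * a3 + a5)) := by
    rw [eq_div_iff hD']
    linear_combination -a1 * hs - (2 * a3 + a5) * ht
  have e2 : (2 * a3 + a5) * s ^ 2 + a2 * t ^ 2 =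
      (a1 * a2 - (2 * a3 + a5) ^ 2) / (a1 + a2 - 2 * (2 * a3 + a5)) := by
    rw [eq_div_iff hD']
    linear_combination -(2 * a3 + a5) * hs - a2 * ht
  refine ⟨![s, 0, t], ![s, 0, t], ?_, ?_, fun i => ?_, fun l => ?_⟩
  · simpa [Fin.sum_univ_three] using hst
  · simpa [Fin.sum_univ_three] using hst
  · fin_cases i
    · simp [Fin.sum_univ_three, transC, orthoC]
      linear_combination s * e1
    · simp [Fin.sum_univ_three, transC, orthoC]
    · simp [Fin.sum_univ_three, transC, orthoC]
      linear_combination t * e2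
  · fin_cases l
    · simp [Fin.sum_univ_three, transC, orthoC]
      linear_combination s * e1
    · simp [Fin.sum_univ_three, transC, orthoC]
    · simp [Fin.sum_univ_three, transC, orthoC]
      linear_combination t * e2
end

section
/- Let C be the transversely isotropic elasticity tensor with parameters α₁, α₂, α₃, α₄, α₅ ∈ ℝ. If α₁ > 0, α₂ > 0, α₃ > 0, α₄ > 0, |α₅| < √(α₁α₂), and either |2α₃ + α₅| < √(α₁α₂) or 2α₃ + α₅ > (α₁ + α₂)/2, then C is strongly elliptic. -/
/-- The biquadratic form of a transversely isotropic tensor, written through the dot product and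
the cross product of the horizontal parts of the two vectors. -/
theorem transC_form_eq (a1 a2 a3 a4 a5 : ℝ) (x y : Fin 3 → ℝ) :
    ∑ i, ∑ j, ∑ k, ∑ l, transC a1 a2 a3 a4 a5 i j k l * x i * y j * x k * y l =
      a1 * (x 0 * y 0 + x 1 * y 1) ^ 2 + a2 * (x 2 * y 2) ^ 2 +
      a3 * ((x 0 * y 2) ^ 2 + (x 1 * y 2) ^ 2 + (x 2 * y 0) ^ 2 + (x 2 * y 1) ^ 2) +
      a4 * (x 0 * y 1 - x 1 * y 0) ^ 2 +
      2 * (a3 + a5) * ((x 0 * y 0 + x 1 * y 1) * (x 2 * y 2)) := by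
  simp [Fin.sum_univ_three, transC, orthoC]
  ring

theorem sum_sq_fin_three_pos {x : Fin 3 → ℝ} (hx : x ≠ 0) :
    0 < x 0 ^ 2 + x 1 ^ 2 + x 2 ^ 2 := by
  obtain ⟨i, hi⟩ := Function.ne_iff.mp hx
  have hi' : 0 < x i ^ 2 := sq_pos_of_ne_zero hi
  fin_cases i <;> simp at hi' <;> positivity

/-- A weighted inequality between the arithmetic and geometric means. -/
theorem weighted_two_mul_le {a b r : ℝ} (ha : 0 < a) (hr : r ^ 2 = a * b) (s t : ℝ) :
    2 * r * (s * t) ≤ a * s ^ 2 + b * t ^ 2 := by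
  refine le_of_mul_le_mul_left ?_ ha
  have h : a * (b * t ^ 2) = r ^ 2 * t ^ 2 := by rw [hr]; ring
  nlinarith [sq_nonneg (a * s - r * t)]

/-- A transversely isotropic tensor with positive `a1, …, a4` is strongly elliptic as soon as
`a5 < √(a1 * a2)` and `-√(a1 * a2) < 2 * a3 + a5`. -/
theorem stronglyElliptic_transC {a1 a2 a3 a4 a5 r : ℝ}
    (h1 : 0 < a1) (h2 : 0 < a2) (h3 : 0 < a3) (h4 : 0 < a4) (hr : r ^ 2 = a1 * a2)
    (h5 : a5 < r) (h6 : -r < 2 * a3 + a5) :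
    StronglyElliptic (transC a1 a2 a3 a4 a5) := by
  intro x y hx hy
  rw [transC_form_eq]
  set s := x 0 * y 0 + x 1 * y 1 with hs
  set t := x 2 * y 2 with ht
  set w := x 0 * y 1 - x 1 * y 0 with hw
  set q := (x 0 * y 2) ^ 2 + (x 1 * y 2) ^ 2 + (x 2 * y 0) ^ 2 + (x 2 * y 1) ^ 2 with hq
  have hw4 : 0 ≤ a4 * w ^ 2 := by positivity
  rcases lt_trichotomy (s * t) 0 with hst | hst | hst
  · have hq2 : -(2 * (s * t)) ≤ q := by
      rw [hs, ht, hq]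
      nlinarith [sq_nonneg (x 0 * y 2 + x 2 * y 0), sq_nonneg (x 1 * y 2 + x 2 * y 1)]
    have hst2 := weighted_two_mul_le h1 ((neg_sq r).trans hr) s t
    nlinarith [mul_le_mul_of_nonneg_left hq2 h3.le, mul_pos (sub_pos.2 h5) (neg_pos.2 hst)]
  · have hpos : 0 < s ^ 2 + t ^ 2 + q + w ^ 2 := by
      have h := mul_pos (sum_sq_fin_three_pos hx) (sum_sq_fin_three_pos hy)
      rw [hs, ht, hq, hw]
      linarith
    have hq0 : 0 ≤ q := by positivity
    obtain ⟨m, hm, hm1, hm2, hm3, hm4⟩ : ∃ m, 0 < m ∧ m ≤ a1 ∧ m ≤ a2 ∧ m ≤ a3 ∧ m ≤ a4 :=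
      ⟨min (min a1 a2) (min a3 a4), by simp [h1, h2, h3, h4], by simp, by simp, by simp, by simp⟩
    rw [hst, mul_zero, add_zero]
    calc 0 < m * (s ^ 2 + t ^ 2 + q + w ^ 2) := mul_pos hm hpos
      _ = m * s ^ 2 + m * t ^ 2 + m * q + m * w ^ 2 := by ring
      _ ≤ _ := by gcongr
  · have hq2 : 2 * (s * t) ≤ q := by
      rw [hs, ht, hq]
      nlinarith [sq_nonneg (x 0 * y 2 - x 2 * y 0), sq_nonneg (x 1 * y 2 - x 2 * y 1)]
    have hst2 := weighted_two_mul_le h1 hr s t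
    nlinarith [mul_le_mul_of_nonneg_left hq2 h3.le, mul_pos (neg_lt_iff_pos_add.1 h6) hst]

theorem stmt12 (a1 a2 a3 a4 a5 : ℝ)
    (h1 : a1 > 0) (h2 : a2 > 0) (h3 : a3 > 0) (h4 : a4 > 0)
    (h5 : |a5| < Real.sqrt (a1 * a2))
    (h6 : |2 * a3 + a5| < Real.sqrt (a1 * a2) ∨ 2 * a3 + a5 > (a1 + a2) / 2) :
    StronglyElliptic (transC a1 a2 a3 a4 a5) := by
  refine stronglyElliptic_transC h1 h2 h3 h4 (Real.sq_sqrt (mul_pos h1 h2).le)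
    (abs_lt.1 h5).2 ?_
  rcases h6 with h6 | h6
  · exact (abs_lt.1 h6).1
  · linarith [Real.sqrt_nonneg (a1 * a2)]
end

section
/- Let C be the transversely isotropic elasticity tensor with parameters α₁, α₂, α₃, α₄, α₅ ∈ ℝ, and set D = 4α₃ + 2α₅ − α₁ − α₂. Then α₁ and α₂ are Z-eigenvalues of C; moreover, if D ≠ 0, (2α₃ + α₅ − α₁)/D ≥ 0, and (2α₃ + α₅ − α₂)/D ≥ 0, then (α₁α₂ − (2α₃ + α₅)²)/(α₁ + α₂ − 2(2α₃ + α₅)) is also a Z-eigenvalue of C. -/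
/-- In the meridian plane `x 1 = 0`, the Z-eigenvalue equations of `transC` reduce to two scalar
equations. -/
theorem isZEigenvalue_transC_of_meridian {a1 a2 a3 a4 a5 η p q : ℝ} (h : p ^ 2 + q ^ 2 = 1)
    (hp : (a1 * p ^ 2 + (2 * a3 + a5) * q ^ 2) * p = η * p)
    (hq : ((2 * a3 + a5) * p ^ 2 + a2 * q ^ 2) * q = η * q) :
    IsZEigenvalue (transC a1 a2 a3 a4 a5) η := by
  refine ⟨![p, 0, q], by simpa [Fin.sum_univ_three] using h, fun i => ?_⟩
  fin_cases i
  · simp [Fin.sum_univ_three, transC, orthoC]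
    linear_combination hp
  · simp [Fin.sum_univ_three, transC, orthoC]
  · simp [Fin.sum_univ_three, transC, orthoC]
    linear_combination hq

theorem stmt13 (a1 a2 a3 a4 a5 : ℝ) :
    IsZEigenvalue (transC a1 a2 a3 a4 a5) a1 ∧
    IsZEigenvalue (transC a1 a2 a3 a4 a5) a2 ∧
    (4 * a3 + 2 * a5 - a1 - a2 ≠ 0 →
      (2 * a3 + a5 - a1) / (4 * a3 + 2 * a5 - a1 - a2) ≥ 0 →
      (2 * a3 + a5 - a2) / (4 * a3 + 2 * a5 - a1 - a2) ≥ 0 →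
      IsZEigenvalue (transC a1 a2 a3 a4 a5)
        ((a1 * a2 - (2 * a3 + a5) ^ 2) / (a1 + a2 - 2 * (2 * a3 + a5)))) := by
  refine ⟨isZEigenvalue_transC_of_meridian (p := 1) (q := 0) (by norm_num) (by ring) (by ring),
    isZEigenvalue_transC_of_meridian (p := 0) (q := 1) (by norm_num) (by ring) (by ring),
    fun hD h1 h2 => ?_⟩
  have hη : a1 + a2 - 2 * (2 * a3 + a5) = -(4 * a3 + 2 * a5 - a1 - a2) := by ring
  rw [hη]
  refine isZEigenvalue_transC_of_meridian
    (p := √((2 * a3 + a5 - a2) / (4 * a3 + 2 * a5 - a1 - a2)))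
    (q := √((2 * a3 + a5 - a1) / (4 * a3 + 2 * a5 - a1 - a2))) ?_ ?_ ?_
  all_goals
    rw [Real.sq_sqrt h1, Real.sq_sqrt h2]
    clear h1 h2 hη
    generalize hd : 4 * a3 + 2 * a5 - a1 - a2 = d at hD ⊢
    obtain rfl : a2 = 4 * a3 + 2 * a5 - a1 - d := by linarith
  · field_simp
    ring
  all_goals
    congr 1
    field_simp
    ring
end

section
/- Let C be the tetragonal elasticity tensor with parameters α₁, α₂, α₃, α₄, α₅, α₆ ∈ ℝ. Then each of the six numbers α₁, α₂, α₃, α₄, (α₆ + 2α₄ + α₁)/2, and (α₁ − α₆)/2 is an M-eigenvalue of C. -/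
/-- The tetragonal elasticity tensor with parameters `a1, …, a6`. -/
def tetraC (a1 a2 a3 a4 a5 a6 : ℝ) : Fin 3 → Fin 3 → Fin 3 → Fin 3 → ℝ :=
  orthoC a1 a1 a2 a3 a3 a4 a5 a5 a6

theorem stmt14 (a1 a2 a3 a4 a5 a6 : ℝ) :
    IsMEigenvalue (tetraC a1 a2 a3 a4 a5 a6) a1 ∧
    IsMEigenvalue (tetraC a1 a2 a3 a4 a5 a6) a2 ∧
    IsMEigenvalue (tetraC a1 a2 a3 a4 a5 a6) a3 ∧
    IsMEigenvalue (tetraC a1 a2 a3 a4 a5 a6) a4 ∧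
    IsMEigenvalue (tetraC a1 a2 a3 a4 a5 a6) ((a6 + 2 * a4 + a1) / 2) ∧
    IsMEigenvalue (tetraC a1 a2 a3 a4 a5 a6) ((a1 - a6) / 2) := by
  have hs : (√(1 / 2) : ℝ) ^ 2 = 1 / 2 := Real.sq_sqrt (by norm_num)
  generalize √(1 / 2 : ℝ) = s at hs
  refine ⟨⟨![1, 0, 0], ![1, 0, 0], ?_⟩, ⟨![0, 0, 1], ![0, 0, 1], ?_⟩, ⟨![1, 0, 0], ![0, 0, 1], ?_⟩,
    ⟨![1, 0, 0], ![0, 1, 0], ?_⟩, ⟨![s, s, 0], ![s, s, 0], ?_⟩, ⟨![s, s, 0], ![s, -s, 0], ?_⟩⟩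
  case refine_1 | refine_2 | refine_3 | refine_4 =>
    simp [Fin.forall_fin_succ, Fin.sum_univ_three, tetraC, orthoC]
  all_goals
    simp [Fin.forall_fin_succ, Fin.sum_univ_three, tetraC, orthoC]
    grind
end

section
/- Let C be the tetragonal elasticity tensor with parameters α₁, α₂, α₃, α₄, α₅, α₆ ∈ ℝ, and set ζ = (α₆ + 2α₄ + α₁)/2. If α₁ > 0, α₂ > 0, α₃ > 0, α₄ > 0, α₆ + 2α₄ + α₁ > 0, α₁ > α₆, |α₅| < √(α₁α₂), |α₅| < √(ζα₂), (|2α₃ + α₅| < √(α₁α₂) or 2α₃ + α₅ > (α₁ + α₂)/2), and (|2α₃ + α₅| < √(ζα₂) or 2α₃ + α₅ > (ζ + α₂)/2), then C is strongly elliptic. -/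
/-- The quadratic form of the tetragonal tensor, grouped into squares up to one binary form. -/
lemma tetraC_sum_eq (a1 a2 a3 a4 a5 a6 : ℝ) (x y : Fin 3 → ℝ) :
    ∑ i, ∑ j, ∑ k, ∑ l, tetraC a1 a2 a3 a4 a5 a6 i j k l * x i * y j * x k * y l =
      a3 * ((x 0 * y 2 + x 2 * y 0) ^ 2 + (x 1 * y 2 + x 2 * y 1) ^ 2) +
      (a2 * (x 2 * y 2) ^ 2 + 2 * a5 * (x 2 * y 2) * (x 0 * y 0 + x 1 * y 1) +
        (a1 + a6) / 2 * (x 0 * y 0 + x 1 * y 1) ^ 2) +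
      (a1 - a6) / 2 * (x 0 * y 0 - x 1 * y 1) ^ 2 + a4 * (x 0 * y 1 + x 1 * y 0) ^ 2 := by
  simp [Fin.sum_univ_three, tetraC, orthoC]
  ring

lemma binary_form_nonneg {a b c : ℝ} (ha : 0 < a) (h : b ^ 2 < a * c) (s t : ℝ) :
    0 ≤ a * s ^ 2 + 2 * b * s * t + c * t ^ 2 := by
  refine (mul_nonneg_iff_of_pos_left ha).1 ?_
  nlinarith [sq_nonneg (a * s + b * t), mul_nonneg (sub_nonneg.2 h.le) (sq_nonneg t)]

lemma eq_zero_of_binary_form_nonpos {a b c s t : ℝ} (ha : 0 < a) (h : b ^ 2 < a * c)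
    (hst : a * s ^ 2 + 2 * b * s * t + c * t ^ 2 ≤ 0) : s = 0 ∧ t = 0 := by
  have ht : t = 0 := by
    by_contra ht
    have := mul_pos (sub_pos.2 h) (sq_pos_of_ne_zero ht)
    nlinarith [sq_nonneg (a * s + b * t), mul_nonneg ha.le (sub_nonneg.2 hst)]
  subst ht
  refine ⟨?_, rfl⟩
  by_contra hs
  nlinarith [mul_pos ha (sq_pos_of_ne_zero hs)]

/-- Two vectors with vanishing symmetrized tensor product cannot both be nonzero. -/
lemma eq_zero_or_eq_zero_of_symm_tmul {x y : Fin 3 → ℝ} (h00 : x 0 * y 0 = 0)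
    (h11 : x 1 * y 1 = 0) (h22 : x 2 * y 2 = 0) (h01 : x 0 * y 1 + x 1 * y 0 = 0)
    (h02 : x 0 * y 2 + x 2 * y 0 = 0) (h12 : x 1 * y 2 + x 2 * y 1 = 0) : x = 0 ∨ y = 0 := by
  by_contra! hxy
  obtain ⟨hx, hy⟩ := hxy
  have key : (x 0 ^ 2 + x 1 ^ 2 + x 2 ^ 2) * (y 0 ^ 2 + y 1 ^ 2 + y 2 ^ 2) = 0 := by
    linear_combination (x 0 * y 0) * h00 + (x 1 * y 1) * h11 + (x 2 * y 2) * h22 +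
      (x 0 * y 1 + x 1 * y 0) * h01 + (x 0 * y 2 + x 2 * y 0) * h02 +
      (x 1 * y 2 + x 2 * y 1) * h12 - 2 * x 1 * y 1 * h00 - 2 * x 2 * y 2 * h00 -
      2 * x 2 * y 2 * h11
  have aux : ∀ z : Fin 3 → ℝ, z 0 ^ 2 + z 1 ^ 2 + z 2 ^ 2 = 0 → z = 0 := by
    intro z hz
    ext i
    fin_cases i <;> simp only [Fin.zero_eta, Fin.mk_one, Fin.reduceFinMk, Pi.zero_apply] <;>
      nlinarith [sq_nonneg (z 0), sq_nonneg (z 1), sq_nonneg (z 2)]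
  rcases mul_eq_zero.1 key with h | h
  · exact hx (aux x h)
  · exact hy (aux y h)

theorem stmt15 (a1 a2 a3 a4 a5 a6 : ℝ)
    (h1 : a1 > 0) (h2 : a2 > 0) (h3 : a3 > 0) (h4 : a4 > 0)
    (h5 : a6 + 2 * a4 + a1 > 0) (h6 : a1 > a6)
    (h7 : |a5| < Real.sqrt (a1 * a2))
    (h8 : |a5| < Real.sqrt ((a6 + 2 * a4 + a1) / 2 * a2))
    (h9 : |2 * a3 + a5| < Real.sqrt (a1 * a2) ∨ 2 * a3 + a5 > (a1 + a2) / 2)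
    (h10 : |2 * a3 + a5| < Real.sqrt ((a6 + 2 * a4 + a1) / 2 * a2) ∨
      2 * a3 + a5 > ((a6 + 2 * a4 + a1) / 2 + a2) / 2) :
    StronglyElliptic (tetraC a1 a2 a3 a4 a5 a6) := by
  have h7' : a5 ^ 2 < a1 * a2 := Real.lt_sqrt (abs_nonneg _) |>.1 h7 |>.trans_eq' (sq_abs a5)
  have h8' : a5 ^ 2 < (a6 + 2 * a4 + a1) / 2 * a2 :=
    Real.lt_sqrt (abs_nonneg _) |>.1 h8 |>.trans_eq' (sq_abs a5)
  obtain ⟨m, hm, hm1, hm4, hd⟩ : ∃ m : ℝ, 0 < m ∧ m ≤ (a1 - a6) / 2 ∧ m ≤ a4 ∧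
      a5 ^ 2 < a2 * ((a1 + a6) / 2 + m) := by
    rcases le_total ((a1 - a6) / 2) a4 with h | h
    · exact ⟨(a1 - a6) / 2, by linarith, le_rfl, h, by linarith⟩
    · exact ⟨a4, h4, h, le_rfl, by linarith⟩
  intro x y hx hy
  rw [tetraC_sum_eq]
  by_contra! hle
  have hB := binary_form_nonneg h2 hd (x 2 * y 2) (x 0 * y 0 + x 1 * y 1)
  have hE := mul_le_mul_of_nonneg_right hm1 (sq_nonneg (x 0 * y 0 - x 1 * y 1))
  have hG := mul_le_mul_of_nonneg_right hm4 (sq_nonneg (x 0 * y 1 + x 1 * y 0))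
  have hU := mul_nonneg h3.le (sq_nonneg (x 0 * y 2 + x 2 * y 0))
  have hV := mul_nonneg h3.le (sq_nonneg (x 1 * y 2 + x 2 * y 1))
  have hD := mul_nonneg hm.le (sq_nonneg (x 0 * y 1 - x 1 * y 0))
  have hsplit : m * (x 0 * y 0 - x 1 * y 1) ^ 2 + m * (x 0 * y 1 + x 1 * y 0) ^ 2 =
      m * (x 0 * y 0 + x 1 * y 1) ^ 2 + m * (x 0 * y 1 - x 1 * y 0) ^ 2 := by ring
  obtain ⟨hs, ht⟩ := eq_zero_of_binary_form_nonpos h2 hd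
    (s := x 2 * y 2) (t := x 0 * y 0 + x 1 * y 1) (by linarith)
  rw [hs, ht] at hle
  have zero_of : ∀ {a z : ℝ}, 0 < a → a * z ^ 2 ≤ 0 → z = 0 := fun {a z} ha h =>
    pow_eq_zero_iff two_ne_zero |>.1 (le_antisymm (nonpos_of_mul_nonpos_right h ha) (sq_nonneg z))
  have hE0 := mul_nonneg hm.le (sq_nonneg (x 0 * y 0 - x 1 * y 1))
  have hG0 := mul_nonneg hm.le (sq_nonneg (x 0 * y 1 + x 1 * y 0))
  have e : x 0 * y 0 - x 1 * y 1 = 0 := zero_of hm (by linarith)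
  have g : x 0 * y 1 + x 1 * y 0 = 0 := zero_of hm (by linarith)
  have u : x 0 * y 2 + x 2 * y 0 = 0 := zero_of h3 (by linarith)
  have v : x 1 * y 2 + x 2 * y 1 = 0 := zero_of h3 (by linarith)
  rcases eq_zero_or_eq_zero_of_symm_tmul (by linarith) (by linarith) hs g u v with h | h
  · exact hx h
  · exact hy h
end

section
/- Let C be the orthotropic elasticity tensor with parameters δ₁,…,δ₉ ∈ ℝ. Then each of the six numbers δ₁, δ₂, δ₃, δ₄, δ₅, and δ₆ is an M-eigenvalue of C. -/
/-- A pair of coordinate vectors `eₐ`, `e_b` witnesses an M-eigenvalue as soon as the partial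
contractions of `C` along them are diagonal. -/
theorem isMEigenvalue_of_single_s16 {C : Fin 3 → Fin 3 → Fin 3 → Fin 3 → ℝ} {θ : ℝ} (a b : Fin 3)
    (hx : ∀ i, C i b a b = if i = a then θ else 0)
    (hy : ∀ l, C a b a l = if l = b then θ else 0) : IsMEigenvalue C θ := by
  refine ⟨Pi.single a 1, Pi.single b 1, ?_, ?_, fun i => ?_, fun l => ?_⟩
  · simp [Pi.single_apply]
  · simp [Pi.single_apply]
  · simp [Pi.single_apply, hx]
  · simp [Pi.single_apply, hy]

theorem stmt16 (d1 d2 d3 d4 d5 d6 d7 d8 d9 : ℝ) :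
    IsMEigenvalue (orthoC d1 d2 d3 d4 d5 d6 d7 d8 d9) d1 ∧
    IsMEigenvalue (orthoC d1 d2 d3 d4 d5 d6 d7 d8 d9) d2 ∧
    IsMEigenvalue (orthoC d1 d2 d3 d4 d5 d6 d7 d8 d9) d3 ∧
    IsMEigenvalue (orthoC d1 d2 d3 d4 d5 d6 d7 d8 d9) d4 ∧
    IsMEigenvalue (orthoC d1 d2 d3 d4 d5 d6 d7 d8 d9) d5 ∧
    IsMEigenvalue (orthoC d1 d2 d3 d4 d5 d6 d7 d8 d9) d6 := by
  refine ⟨isMEigenvalue_of_single_s16 0 0 ?_ ?_, isMEigenvalue_of_single_s16 1 1 ?_ ?_,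
    isMEigenvalue_of_single_s16 2 2 ?_ ?_, isMEigenvalue_of_single_s16 1 2 ?_ ?_,
    isMEigenvalue_of_single_s16 0 2 ?_ ?_, isMEigenvalue_of_single_s16 0 1 ?_ ?_⟩ <;>
  · intro i
    fin_cases i <;> simp [orthoC]
end

section
/- Let C be the orthotropic elasticity tensor with parameters δ₁,…,δ₉ ∈ ℝ. (a) If δ₂ + δ₃ + 2δ₇ > 0, δ₂ + δ₇ ≥ 0, and δ₃ + δ₇ ≥ 0, then (δ₂δ₃ − δ₇²)/(δ₂ + δ₃ + 2δ₇) is an M-eigenvalue of C. (b) If δ₁ + δ₃ + 2δ₈ > 0, δ₁ + δ₈ ≥ 0, and δ₃ + δ₈ ≥ 0, then (δ₁δ₃ − δ₈²)/(δ₁ + δ₃ + 2δ₈) is an M-eigenvalue of C. (c) If δ₁ + δ₂ + 2δ₉ > 0, δ₁ + δ₉ ≥ 0, and δ₂ + δ₉ ≥ 0, then (δ₁δ₂ − δ₉²)/(δ₁ + δ₂ + 2δ₉) is an M-eigenvalue of C. -/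
/-- Square roots of the normalised weights `q + r` and `p + r` balance the two quadratic
expressions that determine the M-eigenvalue. -/
theorem exists_balanced_unit_pair {p q r : ℝ} (hs : p + q + 2 * r > 0) (hp : p + r ≥ 0)
    (hq : q + r ≥ 0) :
    ∃ a b : ℝ, a ^ 2 + b ^ 2 = 1 ∧
      p * a ^ 2 - r * b ^ 2 = (p * q - r ^ 2) / (p + q + 2 * r) ∧
      q * b ^ 2 - r * a ^ 2 = (p * q - r ^ 2) / (p + q + 2 * r) := by
  have hs' := hs.ne'
  refine ⟨√((q + r) / (p + q + 2 * r)), √((p + r) / (p + q + 2 * r)), ?_, ?_, ?_⟩ <;>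
    rw [Real.sq_sqrt (div_nonneg hq hs.le), Real.sq_sqrt (div_nonneg hp hs.le)]
  · rw [← add_div, div_eq_one_iff_eq hs']
    ring
  · field_simp
    ring
  · field_simp
    ring

theorem stmt17 (d1 d2 d3 d4 d5 d6 d7 d8 d9 : ℝ) :
    (d2 + d3 + 2 * d7 > 0 → d2 + d7 ≥ 0 → d3 + d7 ≥ 0 →
      IsMEigenvalue (orthoC d1 d2 d3 d4 d5 d6 d7 d8 d9)
        ((d2 * d3 - d7 ^ 2) / (d2 + d3 + 2 * d7))) ∧
    (d1 + d3 + 2 * d8 > 0 → d1 + d8 ≥ 0 → d3 + d8 ≥ 0 →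
      IsMEigenvalue (orthoC d1 d2 d3 d4 d5 d6 d7 d8 d9)
        ((d1 * d3 - d8 ^ 2) / (d1 + d3 + 2 * d8))) ∧
    (d1 + d2 + 2 * d9 > 0 → d1 + d9 ≥ 0 → d2 + d9 ≥ 0 →
      IsMEigenvalue (orthoC d1 d2 d3 d4 d5 d6 d7 d8 d9)
        ((d1 * d2 - d9 ^ 2) / (d1 + d2 + 2 * d9))) := by
  refine ⟨fun hs hp hq => ?_, fun hs hp hq => ?_, fun hs hp hq => ?_⟩ <;>
    obtain ⟨a, b, hn, ha, hb⟩ := exists_balanced_unit_pair hs hp hq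
  · refine ⟨![0, a, b], ![0, a, -b], ?_, ?_, fun i => ?_, fun i => ?_⟩
    · simpa [Fin.sum_univ_three] using hn
    · simpa [Fin.sum_univ_three] using hn
    · fin_cases i <;> simp [orthoC, Fin.sum_univ_three]
      · linear_combination a * ha
      · linear_combination b * hb
    · fin_cases i <;> simp [orthoC, Fin.sum_univ_three]
      · linear_combination a * ha
      · linear_combination -b * hb
  · refine ⟨![a, 0, b], ![a, 0, -b], ?_, ?_, fun i => ?_, fun i => ?_⟩
    · simpa [Fin.sum_univ_three] using hn
    · simpa [Fin.sum_univ_three] using hn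
    · fin_cases i <;> simp [orthoC, Fin.sum_univ_three]
      · linear_combination a * ha
      · linear_combination b * hb
    · fin_cases i <;> simp [orthoC, Fin.sum_univ_three]
      · linear_combination a * ha
      · linear_combination -b * hb
  · refine ⟨![a, b, 0], ![a, -b, 0], ?_, ?_, fun i => ?_, fun i => ?_⟩
    · simpa [Fin.sum_univ_three] using hn
    · simpa [Fin.sum_univ_three] using hn
    · fin_cases i <;> simp [orthoC, Fin.sum_univ_three]
      · linear_combination a * ha
      · linear_combination b * hb
    · fin_cases i <;> simp [orthoC, Fin.sum_univ_three]
      · linear_combination a * ha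
      · linear_combination -b * hb
end

section
/- Let C be the orthotropic elasticity tensor with parameters δ₁,…,δ₉ ∈ ℝ, and set D = 4δ₅ + 2δ₈ − δ₁ − δ₃. If D ≠ 0, (2δ₅ + δ₈ − δ₁)/D ≥ 0, and (2δ₅ + δ₈ − δ₃)/D ≥ 0, then (δ₁δ₃ − (2δ₅ + δ₈)²)/(δ₁ + δ₃ − 2(2δ₅ + δ₈)) is an M-eigenvalue of C. Analogously, if D' = 4δ₄ + 2δ₇ − δ₂ − δ₃ satisfies D' ≠ 0, (2δ₄ + δ₇ − δ₂)/D' ≥ 0, and (2δ₄ + δ₇ − δ₃)/D' ≥ 0, then (δ₂δ₃ − (2δ₄ + δ₇)²)/(δ₂ + δ₃ − 2(2δ₄ + δ₇)) is an M-eigenvalue of C. -/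
/-- Some unit vector `(a, b)` has both entries of `!![p, m; m, q] *ᵥ ![a ^ 2, b ^ 2]` equal. -/
lemma exists_unit_vector_sq_equalizing (p q m : ℝ) (hD : 2 * m - p - q ≠ 0)
    (hp : 0 ≤ (m - p) / (2 * m - p - q)) (hq : 0 ≤ (m - q) / (2 * m - p - q)) :
    ∃ a b : ℝ, a ^ 2 + b ^ 2 = 1 ∧
      p * a ^ 2 + m * b ^ 2 = (p * q - m ^ 2) / (p + q - 2 * m) ∧
      m * a ^ 2 + q * b ^ 2 = (p * q - m ^ 2) / (p + q - 2 * m) := by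
  have hD' : p + q - 2 * m = -(2 * m - p - q) := by ring
  refine ⟨√((m - q) / (2 * m - p - q)), √((m - p) / (2 * m - p - q)), ?_⟩
  rw [Real.sq_sqrt hp, Real.sq_sqrt hq, hD']
  refine ⟨?_, ?_, ?_⟩
  · rw [← add_div, div_eq_one_iff_eq hD]
    ring
  all_goals
    field_simp
    ring

lemma isMEigenvalue_orthoC_zero_two {d1 d2 d3 d4 d5 d6 d7 d8 d9 a b θ : ℝ}
    (hab : a ^ 2 + b ^ 2 = 1) (ha : d1 * a ^ 2 + (2 * d5 + d8) * b ^ 2 = θ)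
    (hb : (2 * d5 + d8) * a ^ 2 + d3 * b ^ 2 = θ) :
    IsMEigenvalue (orthoC d1 d2 d3 d4 d5 d6 d7 d8 d9) θ := by
  refine ⟨![a, 0, b], ![a, 0, b], ?_, ?_, fun i => ?_, fun l => ?_⟩
  · simpa [Fin.sum_univ_three] using hab
  · simpa [Fin.sum_univ_three] using hab
  · fin_cases i <;> simp [Fin.sum_univ_three, orthoC]
    · linear_combination a * ha
    · linear_combination b * hb
  · fin_cases l <;> simp [Fin.sum_univ_three, orthoC]
    · linear_combination a * ha
    · linear_combination b * hb

lemma isMEigenvalue_orthoC_one_two {d1 d2 d3 d4 d5 d6 d7 d8 d9 a b θ : ℝ}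
    (hab : a ^ 2 + b ^ 2 = 1) (ha : d2 * a ^ 2 + (2 * d4 + d7) * b ^ 2 = θ)
    (hb : (2 * d4 + d7) * a ^ 2 + d3 * b ^ 2 = θ) :
    IsMEigenvalue (orthoC d1 d2 d3 d4 d5 d6 d7 d8 d9) θ := by
  refine ⟨![0, a, b], ![0, a, b], ?_, ?_, fun i => ?_, fun l => ?_⟩
  · simpa [Fin.sum_univ_three] using hab
  · simpa [Fin.sum_univ_three] using hab
  · fin_cases i <;> simp [Fin.sum_univ_three, orthoC]
    · linear_combination a * ha
    · linear_combination b * hb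
  · fin_cases l <;> simp [Fin.sum_univ_three, orthoC]
    · linear_combination a * ha
    · linear_combination b * hb

theorem stmt18 (d1 d2 d3 d4 d5 d6 d7 d8 d9 : ℝ) :
    (4 * d5 + 2 * d8 - d1 - d3 ≠ 0 →
      (2 * d5 + d8 - d1) / (4 * d5 + 2 * d8 - d1 - d3) ≥ 0 →
      (2 * d5 + d8 - d3) / (4 * d5 + 2 * d8 - d1 - d3) ≥ 0 →
      IsMEigenvalue (orthoC d1 d2 d3 d4 d5 d6 d7 d8 d9)
        ((d1 * d3 - (2 * d5 + d8) ^ 2) / (d1 + d3 - 2 * (2 * d5 + d8)))) ∧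
    (4 * d4 + 2 * d7 - d2 - d3 ≠ 0 →
      (2 * d4 + d7 - d2) / (4 * d4 + 2 * d7 - d2 - d3) ≥ 0 →
      (2 * d4 + d7 - d3) / (4 * d4 + 2 * d7 - d2 - d3) ≥ 0 →
      IsMEigenvalue (orthoC d1 d2 d3 d4 d5 d6 d7 d8 d9)
        ((d2 * d3 - (2 * d4 + d7) ^ 2) / (d2 + d3 - 2 * (2 * d4 + d7)))) := by
  constructor <;> intro hD hp hq
  · rw [show 4 * d5 + 2 * d8 - d1 - d3 = 2 * (2 * d5 + d8) - d1 - d3 by ring] at hD hp hq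
    obtain ⟨a, b, hab, ha, hb⟩ := exists_unit_vector_sq_equalizing d1 d3 (2 * d5 + d8) hD hp hq
    exact isMEigenvalue_orthoC_zero_two hab ha hb
  · rw [show 4 * d4 + 2 * d7 - d2 - d3 = 2 * (2 * d4 + d7) - d2 - d3 by ring] at hD hp hq
    obtain ⟨a, b, hab, ha, hb⟩ := exists_unit_vector_sq_equalizing d2 d3 (2 * d4 + d7) hD hp hq
    exact isMEigenvalue_orthoC_one_two hab ha hb
end
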